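/- arXiv:2409.08863 — 4 statements merged into one kernel-verified Lean document; each statement's English description precedes it below -/
import Mathlib

section
/- For each n ≥ 2 let μ^{(n)}_1, …, μ^{(n)}_n be real numbers, τ_n ∈ {2, …, n} and d_n > 0 be such that μ^{(n)}_i = μ^{(n)}_1 for 1 ≤ i ≤ τ_n−1 and μ^{(n)}_i − μ^{(n)}_1 ≥ d_n for τ_n ≤ i ≤ n. If n^{−3/2} τ_n (n − τ_n) d_n → ∞ as n → ∞, then n^{−1/2} min_{1 ≤ j ≤ n} M_n(j) → −∞ as n → ∞. -/
open Finset Filter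

/-- If `n^{-3/2} τ_n (n - τ_n) d_n → ∞` then the rescaled minimum
`n^{-1/2} min_{1 ≤ j ≤ n} M_n(j)` tends to `-∞`. -/
theorem stmt_3 (μ : ℕ → ℕ → ℝ) (τ : ℕ → ℕ) (d : ℕ → ℝ)
    (M : ℕ → ℕ → ℝ)
    (hM : ∀ n j, M n j = ∑ i ∈ Icc 1 j, (μ n i - (n : ℝ)⁻¹ * ∑ l ∈ Icc 1 n, μ n l))
    (hτ : ∀ n, 2 ≤ n → 2 ≤ τ n ∧ τ n ≤ n)
    (hd : ∀ n, 2 ≤ n → 0 < d n)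
    (hpre : ∀ n, 2 ≤ n → ∀ i, 1 ≤ i → i ≤ τ n - 1 → μ n i = μ n 1)
    (hgap : ∀ n, 2 ≤ n → ∀ i, τ n ≤ i → i ≤ n → d n ≤ μ n i - μ n 1)
    (hdiv : Tendsto (fun n : ℕ => (n : ℝ) ^ (-(3 : ℝ) / 2) * (τ n : ℝ) * ((n : ℝ) - τ n) * d n)
      atTop atTop) :
    Tendsto
      (fun n : ℕ => (n : ℝ) ^ (-(1 : ℝ) / 2) * sInf {x : ℝ | ∃ j, 1 ≤ j ∧ j ≤ n ∧ x = M n j})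
      atTop atBot := by
  have h2 := (tendsto_neg_atTop_atBot.comp (hdiv.atTop_div_const (r := 2) (by norm_num)))
  refine tendsto_atBot_mono' atTop ?_ h2
  filter_upwards [eventually_ge_atTop 2] with n hn
  obtain ⟨ht2, htn⟩ := hτ n hn
  have hdn := hd n hn
  have hn0 : (0 : ℝ) < n := by
    have : 0 < n := by omega
    exact_mod_cast this
  have hS : ((n : ℝ) - τ n) * d n ≤ ∑ l ∈ Icc 1 n, (μ n l - μ n 1) := by
    have h1 : ∑ l ∈ Icc (τ n) n, (μ n l - μ n 1) ≤ ∑ l ∈ Icc 1 n, (μ n l - μ n 1) := by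
      apply Finset.sum_le_sum_of_subset_of_nonneg
      · exact Finset.Icc_subset_Icc (by omega) le_rfl
      · intro i hi hi'
        simp only [Finset.mem_Icc] at hi hi'
        rw [hpre n hn i hi.1 (by omega)]
        simp
    have h3 : ∑ l ∈ Icc (τ n) n, d n ≤ ∑ l ∈ Icc (τ n) n, (μ n l - μ n 1) := by
      apply Finset.sum_le_sum
      intro i hi
      simp only [Finset.mem_Icc] at hi
      exact hgap n hn i hi.1 hi.2
    rw [Finset.sum_const, Nat.card_Icc, nsmul_eq_mul, Nat.cast_sub (by omega)] at h3
    push_cast at h3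
    nlinarith
  rw [Finset.sum_sub_distrib, Finset.sum_const, Nat.card_Icc, nsmul_eq_mul] at hS
  simp only [Nat.add_sub_cancel] at hS
  have hMt : M n (τ n - 1) ≤ -((τ n : ℝ) * ((n : ℝ) - τ n) * d n / 2) * (n : ℝ)⁻¹ := by
    rw [hM, Finset.sum_congr rfl (g := fun _ => μ n 1 - (n : ℝ)⁻¹ * ∑ l ∈ Icc 1 n, μ n l)
      (fun i hi => by
        simp only [Finset.mem_Icc] at hi
        rw [hpre n hn i hi.1 hi.2])]
    rw [Finset.sum_const, Nat.card_Icc, nsmul_eq_mul, Nat.add_sub_cancel,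
      Nat.cast_sub (by omega)]
    generalize ∑ l ∈ Icc 1 n, μ n l = S at hS ⊢
    have e : μ n 1 - (n : ℝ)⁻¹ * S = -(S - n * μ n 1) * (n : ℝ)⁻¹ := by
      field_simp
      ring
    rw [e, ← mul_assoc]
    refine mul_le_mul_of_nonneg_right ?_ (by positivity)
    have ht : (2 : ℝ) ≤ τ n := by exact_mod_cast ht2
    have htn' : (τ n : ℝ) ≤ n := by exact_mod_cast htn
    have h4 : 0 ≤ ((n : ℝ) - τ n) * d n := mul_nonneg (by linarith) hdn.le
    push_cast
    nlinarith [mul_le_mul_of_nonneg_left hS (by linarith : (0 : ℝ) ≤ τ n - 1)]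
  have hinf : sInf {x : ℝ | ∃ j, 1 ≤ j ∧ j ≤ n ∧ x = M n j} ≤ M n (τ n - 1) := by
    apply csInf_le
    · have : {x : ℝ | ∃ j, 1 ≤ j ∧ j ≤ n ∧ x = M n j} = (M n) '' (Set.Icc 1 n) := by
        ext x
        constructor
        · rintro ⟨j, a, b, c⟩
          exact ⟨j, ⟨a, b⟩, c.symm⟩
        · rintro ⟨j, ⟨a, b⟩, c⟩
          exact ⟨j, a, b, c.symm⟩
      rw [this]
      exact ((Set.finite_Icc 1 n).image _).bddBelow
    · exact ⟨τ n - 1, by omega, by omega, rfl⟩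
  have hp : (n : ℝ) ^ (-(3 : ℝ) / 2) = (n : ℝ) ^ (-(1 : ℝ) / 2) * (n : ℝ)⁻¹ := by
    rw [← Real.rpow_neg_one, ← Real.rpow_add hn0]
    norm_num
  have h5 := mul_le_mul_of_nonneg_left (hinf.trans hMt)
    (Real.rpow_nonneg hn0.le (-(1 : ℝ) / 2))
  refine h5.trans (le_of_eq ?_)
  simp only [Function.comp]
  rw [hp]
  ring
end

section
/- Let δ : ℕ → ℝ satisfy δ_i ≥ 0 for all i and be summable, and set Θ_j := Σ_{i=j}^{∞} δ_i for j ≥ 0. Let γ : ℤ → ℝ satisfy |γ(k)| ≤ Σ_{i=0}^{∞} δ_{i+|k|} δ_i for every k ∈ ℤ. Then (a) Σ_{k=−∞}^{∞} |γ(k)| ≤ Θ_0², and (b) if moreover Σ_{j=0}^{∞} Θ_j < ∞, then Σ_{k=−∞}^{∞} |k| |γ(k)| ≤ 2 Θ_0 Σ_{j=0}^{∞} Θ_j. -/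
/-- The bijection `(k, i) ↦ (i + k⁺, i + k⁻)`. -/
def diagEquiv : ℤ × ℕ ≃ ℕ × ℕ where
  toFun p := (p.2 + p.1.toNat, p.2 + (-p.1).toNat)
  invFun q := ((q.1 : ℤ) - q.2, min q.1 q.2)
  left_inv p := by
    rcases p with ⟨k, i⟩
    ext <;> simp <;> omega
  right_inv q := by
    rcases q with ⟨a, b⟩
    ext <;> simp <;> omega

lemma diag_sum (G : ℕ × ℕ → ℝ) (hs : Summable G) :
    (∀ k : ℤ, Summable fun i : ℕ => G (diagEquiv (k, i))) ∧
    (Summable fun k : ℤ => ∑' i : ℕ, G (diagEquiv (k, i))) ∧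
    (∑' k : ℤ, ∑' i : ℕ, G (diagEquiv (k, i))) = ∑' q, G q := by
  have h : Summable fun p : ℤ × ℕ => G (diagEquiv p) := diagEquiv.summable_iff.mpr hs
  refine ⟨fun k => h.prod_factor k, h.prod, ?_⟩
  rw [← h.tsum_prod, diagEquiv.tsum_eq G]

lemma diag_mul (δ : ℕ → ℝ) (k : ℤ) (i : ℕ) :
    δ (diagEquiv (k, i)).1 * δ (diagEquiv (k, i)).2 = δ (i + k.natAbs) * δ i := by
  simp only [diagEquiv, Equiv.coe_fn_mk]
  rcases le_total 0 k with h | h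
  · rw [show k.toNat = k.natAbs by omega, show (-k).toNat = 0 by omega, add_zero]
  · rw [show (-k).toNat = k.natAbs by omega, show k.toNat = 0 by omega, add_zero, mul_comm]

lemma weighted (δ : ℕ → ℝ) (hδ : ∀ i, 0 ≤ δ i) (hsum : Summable δ)
    (h : Summable fun j : ℕ => ∑' i : ℕ, δ (j + i)) :
    (Summable fun a : ℕ => (a : ℝ) * δ a) ∧
      ∑' a : ℕ, (a : ℝ) * δ a ≤ ∑' j : ℕ, ∑' i : ℕ, δ (j + i) := by
  have hp : Summable fun p : ℕ × ℕ => δ (p.1 + p.2) := by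
    refine (summable_prod_of_nonneg (fun p => hδ _)).mpr ⟨fun j => ?_, h⟩
    exact hsum.comp_injective (add_right_injective j)
  have hq : Summable fun x : Σ n : ℕ, Finset.HasAntidiagonal.antidiagonal n => δ (x.2.1.1 + x.2.1.2) :=
    Finset.HasAntidiagonal.sigmaAntidiagonalEquivProd.summable_iff.mpr hp
  have he : ∀ n : ℕ, ∑' c : Finset.HasAntidiagonal.antidiagonal n, δ (c.1.1 + c.1.2) = ((n : ℝ) + 1) * δ n := by
    intro n
    rw [tsum_fintype]
    rw [Finset.sum_congr rfl (g := fun _ => δ n)]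
    · simp
    · intro c _
      rw [Finset.HasAntidiagonal.mem_antidiagonal.mp c.2]
  have hs : Summable fun n : ℕ => ((n : ℝ) + 1) * δ n := by
    have := hq.sigma
    simpa only [he] using this
  have ht : ∑' n : ℕ, ((n : ℝ) + 1) * δ n = ∑' j : ℕ, ∑' i : ℕ, δ (j + i) := by
    rw [← hp.tsum_prod]
    rw [← Finset.HasAntidiagonal.sigmaAntidiagonalEquivProd.tsum_eq (fun p : ℕ × ℕ => δ (p.1 + p.2))]
    have := hq.tsum_sigma
    simp only [he] at this
    exact this.symm
  have hle : ∀ n : ℕ, (n : ℝ) * δ n ≤ ((n : ℝ) + 1) * δ n := fun n => by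
    have := hδ n
    nlinarith
  have hs' : Summable fun a : ℕ => (a : ℝ) * δ a :=
    Summable.of_nonneg_of_le (fun n => mul_nonneg n.cast_nonneg (hδ n)) hle hs
  exact ⟨hs', ht ▸ hs'.tsum_le_tsum hle hs⟩


/-- Bounds on the autocovariances via the physical dependence measures:
`Σ_k |γ(k)| ≤ Θ_0²` and `Σ_k |k||γ(k)| ≤ 2 Θ_0 Σ_j Θ_j`,
where `Θ_j = Σ_{i ≥ j} δ_i`. -/
theorem stmt_4 (δ : ℕ → ℝ) (hδ : ∀ i, 0 ≤ δ i) (hsum : Summable δ)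
    (γ : ℤ → ℝ)
    (hγ : ∀ k : ℤ, |γ k| ≤ ∑' i : ℕ, δ (i + k.natAbs) * δ i) :
    (Summable fun k : ℤ => |γ k|) ∧
    (∑' k : ℤ, |γ k|) ≤ (∑' i : ℕ, δ i) ^ 2 ∧
    ((Summable fun j : ℕ => ∑' i : ℕ, δ (j + i)) →
      (Summable fun k : ℤ => |(k : ℝ)| * |γ k|) ∧
      (∑' k : ℤ, |(k : ℝ)| * |γ k|)
        ≤ 2 * (∑' i : ℕ, δ i) * ∑' j : ℕ, ∑' i : ℕ, δ (j + i)) := by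
  have hG : Summable fun q : ℕ × ℕ => δ q.1 * δ q.2 := hsum.mul_of_nonneg hsum hδ hδ
  obtain ⟨h0, h1, h2⟩ := diag_sum _ hG
  simp only [diag_mul] at h0 h1 h2
  have hS : Summable fun k : ℤ => |γ k| :=
    Summable.of_nonneg_of_le (fun k => abs_nonneg _) hγ h1
  refine ⟨hS, ?_, ?_⟩
  · rw [sq, hsum.tsum_mul_tsum hsum hG, ← h2]
    exact hS.tsum_le_tsum hγ h1
  · intro hT
    obtain ⟨w1, w2⟩ := weighted δ hδ hsum hT
    have wn : ∀ a : ℕ, 0 ≤ (a : ℝ) * δ a := fun n => mul_nonneg n.cast_nonneg (hδ n)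
    have hA : Summable fun q : ℕ × ℕ => ((q.1 : ℝ) * δ q.1) * δ q.2 :=
      w1.mul_of_nonneg hsum wn hδ
    have hB : Summable fun q : ℕ × ℕ => δ q.1 * ((q.2 : ℝ) * δ q.2) :=
      hsum.mul_of_nonneg w1 hδ wn
    obtain ⟨g0, g1, g2⟩ := diag_sum _ (hA.add hB)
    have hle : ∀ k : ℤ, |(k : ℝ)| * |γ k| ≤ ∑' i : ℕ,
        ((((diagEquiv (k, i)).1 : ℝ) * δ (diagEquiv (k, i)).1) * δ (diagEquiv (k, i)).2 +
        δ (diagEquiv (k, i)).1 * (((diagEquiv (k, i)).2 : ℝ) * δ (diagEquiv (k, i)).2)) := by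
      intro k
      refine (mul_le_mul_of_nonneg_left (hγ k) (abs_nonneg _)).trans ?_
      rw [← tsum_mul_left]
      refine ((h0 k).mul_left _).tsum_le_tsum (fun i => ?_) (g0 k)
      have hk : |(k : ℝ)| ≤ ((diagEquiv (k, i)).1 : ℝ) + ((diagEquiv (k, i)).2 : ℝ) := by
        have : |k| ≤ ((diagEquiv (k, i)).1 : ℤ) + ((diagEquiv (k, i)).2 : ℤ) := by
          simp only [diagEquiv, Equiv.coe_fn_mk]
          rw [abs_le]
          constructor <;> push_cast <;> omega
        exact_mod_cast this
      rw [← diag_mul]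
      have := mul_le_mul_of_nonneg_right hk
        (mul_nonneg (hδ (diagEquiv (k, i)).1) (hδ (diagEquiv (k, i)).2))
      linarith
    have hS2 : Summable fun k : ℤ => |(k : ℝ)| * |γ k| :=
      Summable.of_nonneg_of_le (fun k => by positivity) hle g1
    refine ⟨hS2, (hS2.tsum_le_tsum hle g1).trans ?_⟩
    rw [g2, hA.tsum_add hB, ← w1.tsum_mul_tsum hsum hA, ← hsum.tsum_mul_tsum w1 hB]
    have := mul_le_mul_of_nonneg_left w2 (show 0 ≤ ∑' i : ℕ, δ i from tsum_nonneg hδ)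
    linarith
end

section
/- Let (Ω, F, ℙ) be a probability space, θ > 2, and let Z_1, Z_2, … be real-valued random variables such that for constants C₁, C₂, C₃ > 0 the maximal Nagaev-type inequality ℙ( max_{1 ≤ j ≤ n} | Σ_{i=1}^{j} Z_i | ≥ x ) ≤ C₁ n x^{−θ} + C₂ exp(−C₃ x²/n) holds for every integer n ≥ 1 and every real x > 0. Then for every ε > 0 there exists G > 0 such that for every integer g ≥ 1, ℙ( sup_{j ≥ g} | j^{−1} Σ_{i=1}^{j} Z_i | ≥ G g^{−1/2} ) ≤ ε; that is, max_{j ≥ g} |(1/j) Σ_{i=1}^{j} Z_i| = O_ℙ(g^{−1/2}) uniformly in g. -/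
open MeasureTheory Finset

/-- Under the maximal Nagaev-type inequality, the maximal sample mean beyond time
`g` is `O_ℙ(g^{-1/2})` uniformly in `g`. -/
theorem stmt_8 {Ω : Type*} [MeasurableSpace Ω] (ℙ : Measure Ω) [IsProbabilityMeasure ℙ]
    (θ : ℝ) (hθ : 2 < θ) (Z : ℕ → Ω → ℝ) (hmeas : ∀ i, Measurable (Z i))
    (C₁ C₂ C₃ : ℝ) (hC₁ : 0 < C₁) (hC₂ : 0 < C₂) (hC₃ : 0 < C₃)
    (hNagaev : ∀ n : ℕ, 1 ≤ n → ∀ x : ℝ, 0 < x →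
      ℙ {ω | ∃ j, 1 ≤ j ∧ j ≤ n ∧ x ≤ |∑ i ∈ Icc 1 j, Z i ω|}
        ≤ ENNReal.ofReal (C₁ * n * x ^ (-θ) + C₂ * Real.exp (-C₃ * x ^ 2 / n))) :
    ∀ ε : ℝ, 0 < ε → ∃ G : ℝ, 0 < G ∧ ∀ g : ℕ, 1 ≤ g →
      ℙ {ω | ∃ j : ℕ, g ≤ j ∧
          G * (g : ℝ) ^ (-(1 : ℝ) / 2) ≤ |(j : ℝ)⁻¹ * ∑ i ∈ Icc 1 j, Z i ω|}
        ≤ ENNReal.ofReal ε := by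
  intro ε hε
  set K : ℝ := 2 * C₁ + 2 * C₂ / C₃ with hK
  have hKpos : 0 < K := by positivity
  set G : ℝ := Real.sqrt (1 + 2 * K / ε) with hG
  have hG2 : G ^ 2 = 1 + 2 * K / ε := Real.sq_sqrt (by positivity)
  have hGpos : 0 < G := Real.sqrt_pos.2 (by positivity)
  have hG1 : 1 ≤ G := by
    rw [hG]; apply Real.one_le_sqrt.2
    have : 0 < 2 * K / ε := by positivity
    linarith
  refine ⟨G, hGpos, fun g hg => ?_⟩
  have hg1 : (1 : ℝ) ≤ g := by exact_mod_cast hg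
  have hg0 : (0 : ℝ) < g := by linarith
  set s : ℝ := Real.sqrt g with hs
  have hs2 : s ^ 2 = g := Real.sq_sqrt hg0.le
  have hs1 : 1 ≤ s := Real.one_le_sqrt.2 hg1
  have hs0 : 0 < s := by linarith
  have hrp : (g : ℝ) ^ (-(1 : ℝ) / 2) = s⁻¹ := by
    rw [hs, Real.sqrt_eq_rpow, ← Real.rpow_neg hg0.le]; norm_num
  rw [hrp]
  let A : ℕ → Set Ω := fun k => {ω | ∃ j, 1 ≤ j ∧ j ≤ 2 ^ (k + 1) * g ∧
    G * 2 ^ k * s ≤ |∑ i ∈ Icc 1 j, Z i ω|}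
  have hsub : {ω | ∃ j : ℕ, g ≤ j ∧ G * s⁻¹ ≤ |(j : ℝ)⁻¹ * ∑ i ∈ Icc 1 j, Z i ω|}
      ⊆ ⋃ k, A k := by
    rintro ω ⟨j, hj, h⟩
    have hgp : 0 < g := hg
    have hq : j / g ≠ 0 := (Nat.div_pos hj hgp).ne'
    have h1 : 2 ^ Nat.log 2 (j / g) * g ≤ j :=
      (Nat.le_div_iff_mul_le hgp).1 (Nat.pow_log_le_self 2 hq)
    have h2 : j < 2 ^ (Nat.log 2 (j / g) + 1) * g :=
      (Nat.div_lt_iff_lt_mul hgp).1 (Nat.lt_pow_succ_log_self (by norm_num) _)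
    refine Set.mem_iUnion.2 ⟨Nat.log 2 (j / g), j, by omega, h2.le, ?_⟩
    generalize Nat.log 2 (j / g) = k at h1
    have h1' : (2 : ℝ) ^ k * g ≤ j := by exact_mod_cast h1
    have hj0 : (0 : ℝ) < j := lt_of_lt_of_le (by positivity) h1'
    rw [abs_mul, abs_of_pos (inv_pos.2 hj0), ← div_eq_inv_mul, le_div_iff₀ hj0] at h
    refine le_trans ?_ h
    calc G * 2 ^ k * s = G * s⁻¹ * (2 ^ k * g) := by rw [← hs2]; field_simp
      _ ≤ _ := by gcongr
  have hA : ∀ k, ℙ (A k) ≤ ENNReal.ofReal (K / G ^ 2 * (1 / 2) ^ k) := by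
    intro k
    have h2k : (1 : ℝ) ≤ 2 ^ k := one_le_pow₀ (by norm_num)
    have hx1 : 1 ≤ G * 2 ^ k * s := one_le_mul_of_one_le_of_one_le
      (one_le_mul_of_one_le_of_one_le hG1 h2k) hs1
    have hx0 : 0 < G * 2 ^ k * s := by linarith
    refine (hNagaev (2 ^ (k + 1) * g) (Nat.mul_pos (by positivity) hg) _ hx0).trans ?_
    apply ENNReal.ofReal_le_ofReal
    have e1 : (G * 2 ^ k * s) ^ (-θ) ≤ ((G * 2 ^ k * s) ^ 2)⁻¹ := by
      rw [← Real.rpow_natCast (G * 2 ^ k * s) 2, ← Real.rpow_neg hx0.le]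
      apply Real.rpow_le_rpow_of_exponent_le hx1
      push_cast; linarith
    have hexp : ∀ y : ℝ, 0 < y → Real.exp (-y) ≤ y⁻¹ := by
      intro y hy
      rw [Real.exp_neg]
      apply inv_anti₀ hy
      linarith [Real.add_one_le_exp y]
    have hP : (0 : ℝ) < 2 ^ k := by positivity
    have e2 : -C₃ * (G * 2 ^ k * s) ^ 2 / ((2 ^ (k + 1) * g : ℕ) : ℝ)
        = -(C₃ * G ^ 2 * 2 ^ k / 2) := by
      push_cast
      rw [← hs2, pow_succ (2 : ℝ) k]
      field_simp
    rw [e2]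
    calc _ ≤ C₁ * ((2 ^ (k + 1) * g : ℕ) : ℝ) * ((G * 2 ^ k * s) ^ 2)⁻¹
          + C₂ * (C₃ * G ^ 2 * 2 ^ k / 2)⁻¹ := by
            gcongr
            exact hexp _ (by positivity)
      _ = _ := by
        push_cast
        rw [← hs2, pow_succ (2 : ℝ) k, hK, one_div, inv_pow]
        field_simp
  calc _ ≤ ℙ (⋃ k, A k) := measure_mono hsub
    _ ≤ ∑' k, ℙ (A k) := measure_iUnion_le _
    _ ≤ ∑' k : ℕ, ENNReal.ofReal (K / G ^ 2 * (1 / 2) ^ k) := ENNReal.tsum_le_tsum hA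
    _ = ENNReal.ofReal (∑' k : ℕ, K / G ^ 2 * (1 / 2) ^ k) :=
        (ENNReal.ofReal_tsum_of_nonneg (fun k => by positivity)
          (summable_geometric_two.mul_left _)).symm
    _ ≤ ENNReal.ofReal ε := by
        apply ENNReal.ofReal_le_ofReal
        rw [tsum_mul_left, tsum_geometric_two, hG2, div_mul_eq_mul_div, div_le_iff₀ (by positivity)]
        have : ε * (1 + 2 * K / ε) = ε + 2 * K := by field_simp
        rw [this]; linarith
end

section
/- Let (Ω, F, ℙ) be a probability space, θ > 2, and let Z_1, Z_2, … be real-valued random variables such that for constants C₁, C₂, C₃ > 0 the one-sided maximal Nagaev-type inequality ℙ( max_{1 ≤ j ≤ n} Σ_{i=1}^{j} Z_i ≥ x ) ≤ C₁ n x^{−θ} + C₂ exp(−C₃ x²/n) holds for every integer n ≥ 1 and every real x > 0. Then for every integer M ≥ 1 and every real r > 0, ℙ( ∃ ℓ ≥ M : Σ_{t=1}^{ℓ} Z_t ≥ ℓ r ) ≤ 2C₁ / ((1 − 2^{1−θ}) M^{θ−1} r^{θ}) + C₂ / ( exp(C₃ M r²/2) − 1 ). -/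
open MeasureTheory Finset

/-- Under the one-sided maximal Nagaev-type inequality, the probability that the
random walk ever exceeds the linear boundary `ℓ·r` beyond time `M` is bounded by
a polynomial plus an exponentially small term. -/
theorem stmt_9 {Ω : Type*} [MeasurableSpace Ω] (ℙ : Measure Ω) [IsProbabilityMeasure ℙ]
    (θ : ℝ) (hθ : 2 < θ) (Z : ℕ → Ω → ℝ) (hmeas : ∀ i, Measurable (Z i))
    (C₁ C₂ C₃ : ℝ) (hC₁ : 0 < C₁) (hC₂ : 0 < C₂) (hC₃ : 0 < C₃)
    (hNagaev : ∀ n : ℕ, 1 ≤ n → ∀ x : ℝ, 0 < x →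
      ℙ {ω | ∃ j, 1 ≤ j ∧ j ≤ n ∧ x ≤ ∑ i ∈ Icc 1 j, Z i ω}
        ≤ ENNReal.ofReal (C₁ * n * x ^ (-θ) + C₂ * Real.exp (-C₃ * x ^ 2 / n))) :
    ∀ M : ℕ, 1 ≤ M → ∀ r : ℝ, 0 < r →
      ℙ {ω | ∃ ℓ : ℕ, M ≤ ℓ ∧ (ℓ : ℝ) * r ≤ ∑ t ∈ Icc 1 ℓ, Z t ω}
        ≤ ENNReal.ofReal
            (2 * C₁ / ((1 - (2 : ℝ) ^ (1 - θ)) * (M : ℝ) ^ (θ - 1) * r ^ θ)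
              + C₂ / (Real.exp (C₃ * M * r ^ 2 / 2) - 1)) := by
  intro M hM r hr
  have hM' : (0 : ℝ) < M := by exact_mod_cast hM
  set a : ℝ := C₃ * M * r ^ 2 / 2 with ha
  have ha0 : 0 < a := by positivity
  set q : ℝ := (2 : ℝ) ^ (1 - θ) with hq
  have hq0 : 0 < q := by positivity
  have hq1 : q < 1 := Real.rpow_lt_one_of_one_lt_of_neg (by norm_num) (by linarith)
  have hp0 : 0 < Real.exp (-a) := Real.exp_pos _
  have hp1 : Real.exp (-a) < 1 := by
    rw [Real.exp_lt_one_iff]; linarith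
  set A : ℝ := 2 * C₁ * ((M : ℝ) ^ (θ - 1) * r ^ θ)⁻¹ with hA
  have hA0 : 0 < A := by positivity
  let f : ℕ → ℝ := fun k => A * q ^ k + C₂ * Real.exp (-a) * Real.exp (-a) ^ k
  have hf0 : ∀ k, 0 ≤ f k := fun k => by positivity
  have hsum : HasSum f (A * (1 - q)⁻¹ + C₂ * Real.exp (-a) * (1 - Real.exp (-a))⁻¹) :=
    ((hasSum_geometric_of_lt_one hq0.le hq1).mul_left A).add
      ((hasSum_geometric_of_lt_one hp0.le hp1).mul_left _)
  have hval : A * (1 - q)⁻¹ + C₂ * Real.exp (-a) * (1 - Real.exp (-a))⁻¹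
      = 2 * C₁ / ((1 - q) * (M : ℝ) ^ (θ - 1) * r ^ θ) + C₂ / (Real.exp a - 1) := by
    have h1 : 1 - q ≠ 0 := by linarith
    have h2 : Real.exp a - 1 ≠ 0 := by
      have := Real.one_lt_exp_iff.mpr ha0
      linarith
    congr 1
    · rw [hA, mul_assoc (1 - q), div_eq_mul_inv, mul_inv (1 - q)]
      ring
    · have h3 : 1 - Real.exp (-a) = Real.exp (-a) * (Real.exp a - 1) := by
        rw [mul_sub, ← Real.exp_add]; simp
      rw [h3]
      field_simp
  rw [← hval, ← hsum.tsum_eq, ENNReal.ofReal_tsum_of_nonneg hf0 hsum.summable]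
  have hsub : {ω | ∃ ℓ : ℕ, M ≤ ℓ ∧ (ℓ : ℝ) * r ≤ ∑ t ∈ Icc 1 ℓ, Z t ω} ⊆
      ⋃ k : ℕ, {ω | ∃ j, 1 ≤ j ∧ j ≤ 2 ^ (k + 1) * M ∧
        (2 : ℝ) ^ k * M * r ≤ ∑ i ∈ Icc 1 j, Z i ω} := by
    rintro ω ⟨l, hl, h⟩
    have hne : l / M ≠ 0 := (Nat.div_pos hl hM).ne'
    refine Set.mem_iUnion.mpr ⟨Nat.log 2 (l / M), l, hM.trans hl, ?_, le_trans ?_ h⟩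
    · have := Nat.lt_pow_succ_log_self (b := 2) (by norm_num) (l / M)
      exact ((Nat.div_lt_iff_lt_mul hM).mp this).le
    · have h1 := Nat.pow_log_le_self 2 hne
      have h2 := (Nat.le_div_iff_mul_le hM).mp h1
      have h3 : (2 : ℝ) ^ (Nat.log 2 (l / M)) * M ≤ l := by exact_mod_cast h2
      exact mul_le_mul_of_nonneg_right h3 hr.le
  refine (measure_mono hsub).trans ((measure_iUnion_le _).trans (ENNReal.tsum_le_tsum fun k => ?_))
  have hx : (0 : ℝ) < 2 ^ k * M * r := by positivity
  refine (hNagaev (2 ^ (k + 1) * M) (Nat.mul_pos (by positivity) hM) _ hx).trans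
    (ENNReal.ofReal_le_ofReal (add_le_add (le_of_eq ?_) ?_))
  · push_cast
    have hMθ : (M : ℝ) ^ (-θ) * M = ((M : ℝ) ^ (θ - 1))⁻¹ := by
      rw [← Real.rpow_neg hM'.le, ← Real.rpow_add_one hM'.ne']
      congr 1; ring
    have hqk : ((2 : ℝ) ^ k) ^ (-θ) * 2 ^ k = q ^ k := by
      rw [← Real.rpow_add_one (by positivity), hq, ← Real.rpow_natCast, ← Real.rpow_natCast,
        ← Real.rpow_mul (by norm_num), ← Real.rpow_mul (by norm_num)]
      congr 1; ring
    rw [Real.mul_rpow (by positivity) hr.le, Real.mul_rpow (by positivity) hM'.le, hA, mul_inv,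
      ← hMθ, ← hqk, Real.rpow_neg hr.le, pow_succ]
    ring
  · rw [mul_assoc C₂, ← Real.exp_nat_mul, ← Real.exp_add]
    refine mul_le_mul_of_nonneg_left (Real.exp_le_exp.mpr ?_) hC₂.le
    have h1 : ((k : ℝ) + 1) ≤ 2 ^ k := by exact_mod_cast Nat.lt_two_pow_self (n := k)
    have h2 : -C₃ * (2 ^ k * M * r) ^ 2 / ((2 ^ (k + 1) * M : ℕ) : ℝ) = -(2 ^ k * a) := by
      push_cast
      rw [ha, pow_succ]
      field_simp
      ring
    rw [h2]
    nlinarith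
end
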